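/- For every positive integer n and every integer k ≥ 2, the integer φ(n) − 2k divides Φ_n^{(2k+1)}(1), where Φ_n^{(2k+1)} is the (2k+1)-st formal derivative of the n-th cyclotomic polynomial. -/

import Mathlib

open Polynomial

/-- For `n > 1` the cyclotomic polynomial is self-reciprocal. -/
theorem reverse_cyclotomic_int {n : ℕ} (hn : 1 < n) :
    (cyclotomic n ℤ).reverse = cyclotomic n ℤ := by
  have hpos : 0 < n := by omega
  have hζ := Complex.isPrimitiveRoot_exp n hpos.ne'
  set ζ := Complex.exp (2 * Real.pi * Complex.I / n)
  have hcoeff := cyclotomic_coeff_zero ℤ hn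
  have hdeg : (cyclotomic n ℤ).natTrailingDegree = 0 :=
    natTrailingDegree_eq_zero.2 (Or.inr (by simp [hcoeff]))
  have hmonic : (cyclotomic n ℤ).reverse.Monic := by
    rw [Monic, reverse_leadingCoeff, trailingCoeff, hdeg, hcoeff]
  have hdvd : cyclotomic n ℤ ∣ (cyclotomic n ℤ).reverse := by
    rw [cyclotomic_eq_minpoly hζ hpos]
    refine minpoly.isIntegrallyClosed_dvd (hζ.isIntegral hpos) ?_
    rw [← cyclotomic_eq_minpoly hζ hpos, aeval_def]
    have : NeZero (n : ℂ) := ⟨by exact_mod_cast hpos.ne'⟩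
    let _ : Invertible ζ⁻¹ := invertibleOfNonzero (inv_ne_zero (hζ.ne_zero hpos.ne'))
    have hroot := (eval₂_reverse_eq_zero_iff (algebraMap ℤ ℂ) ζ⁻¹ (cyclotomic n ℤ)).2 (by
      rw [← eval_map, map_cyclotomic]
      exact hζ.inv.isRoot_cyclotomic hpos)
    simpa using hroot
  refine (eq_of_monic_of_dvd_of_natDegree_le (cyclotomic.monic n ℤ) hmonic hdvd ?_)
  exact reverse_natDegree_le _

theorem eval_one_iterate_derivative_eq_sum {R : Type*} [CommRing R] (p : R[X]) (r : ℕ) :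
    (derivative^[r] p).eval 1 =
      ∑ i ∈ Finset.range (p.natDegree + 1), p.coeff i * (descPochhammer R r).eval (i : R) := by
  conv_lhs => rw [p.as_sum_range_C_mul_X_pow]
  simp [iterate_derivative_sum, eval_finsetSum, iterate_derivative_C_mul,
    iterate_derivative_X_pow_eq_natCast_mul, descPochhammer_eval_eq_descFactorial]

theorem descPochhammer_eval_reflect {R : Type*} [CommRing R] (k : ℕ) (x : R) :
    (descPochhammer R (2 * k + 1)).eval (2 * k - x) = -(descPochhammer R (2 * k + 1)).eval x := by
  rw [descPochhammer_eval_eq_prod_range, descPochhammer_eval_eq_prod_range,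
    ← Finset.prod_range_reflect]
  have h : ∀ j ∈ Finset.range (2 * k + 1),
      (2 * k - x - ((2 * k + 1 - 1 - j : ℕ) : R)) = -1 * (x - j) := by
    intro j hj
    rw [Nat.add_sub_cancel, Nat.cast_sub (by grind)]
    push_cast
    ring
  rw [Finset.prod_congr rfl h, Finset.prod_mul_distrib]
  simp [pow_succ, pow_mul]

theorem dvd_descPochhammer_eval_add_eval {R : Type*} [CommRing R] (k : ℕ) (x y : R) :
    x + y - 2 * k ∣
      (descPochhammer R (2 * k + 1)).eval x + (descPochhammer R (2 * k + 1)).eval y := by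
  have h := sub_dvd_eval_sub x (2 * k - y) (descPochhammer R (2 * k + 1))
  rw [descPochhammer_eval_reflect] at h
  convert h using 1 <;> ring

theorem two_mul_sub_dvd_descPochhammer_eval {k : ℕ} (hk : 2 ≤ k) (m : ℤ) :
    2 * (m - k) ∣ (descPochhammer ℤ (2 * k + 1)).eval m := by
  rw [descPochhammer_eval_eq_prod_range]
  have hsub : Finset.Ico k (k + 3) ⊆ Finset.range (2 * k + 1) := by
    intro i hi
    simp only [Finset.mem_Ico, Finset.mem_range] at *
    omega
  refine dvd_trans ?_ (Finset.prod_dvd_prod_of_subset _ _ _ hsub)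
  have h2 : (2 : ℤ) ∣ (m - k - 1) * (m - k - 2) := by
    have := (Int.even_mul_succ_self (m - k - 2)).two_dvd
    rwa [mul_comm, show m - k - 2 + 1 = m - k - 1 by ring] at this
  obtain ⟨c, hc⟩ := h2
  refine ⟨c, ?_⟩
  rw [Finset.prod_Ico_eq_prod_range, Nat.add_sub_cancel_left]
  simp only [Finset.prod_range_succ, Finset.prod_range_zero]
  push_cast
  linear_combination (m - k) * hc

/-- The divisibility holds for every self-reciprocal integer polynomial of even degree. -/
theorem dvd_eval_one_iterate_derivative_of_reverse_eq {p : ℤ[X]} (hp : p.reverse = p) {m k : ℕ}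
    (hdeg : p.natDegree = 2 * m) (hk : 2 ≤ k) :
    2 * ((m : ℤ) - k) ∣ (derivative^[2 * k + 1] p).eval 1 := by
  have hcoeff : ∀ i ≤ 2 * m, p.coeff (2 * m - i) = p.coeff i := by
    intro i hi
    conv_rhs => rw [← hp]
    rw [coeff_reverse, hdeg, revAt_le hi]
  rw [eval_one_iterate_derivative_eq_sum, hdeg,
    show 2 * m + 1 = (m + 1) + m by ring, Finset.sum_range_add, Finset.sum_range_succ,
    ← Finset.sum_range_reflect (n := m) (f := fun x => p.coeff (m + 1 + x) * _),
    add_right_comm, ← Finset.sum_add_distrib]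
  refine dvd_add (Finset.dvd_sum fun i hi => ?_)
    (dvd_mul_of_dvd_right (two_mul_sub_dvd_descPochhammer_eval hk _) _)
  have him : i < m := Finset.mem_range.1 hi
  rw [show m + 1 + (m - 1 - i) = 2 * m - i by omega, hcoeff i (by omega), ← mul_add]
  refine dvd_mul_of_dvd_right ?_ _
  convert dvd_descPochhammer_eval_add_eval k (i : ℤ) ((2 * m - i : ℕ) : ℤ) using 1
  rw [Nat.cast_sub (by omega)]
  push_cast
  ring

theorem cyclotomic_odd_deriv_one_dvd (n k : ℕ) (hn : 0 < n) (hk : 2 ≤ k) :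
    ((Nat.totient n : ℤ) - 2 * (k : ℤ)) ∣
      (Polynomial.derivative^[2 * k + 1] (Polynomial.cyclotomic n ℤ)).eval 1 := by
  rcases Nat.lt_or_ge 2 n with h | h
  · obtain ⟨m, hm⟩ := (Nat.totient_even h).two_dvd
    have := dvd_eval_one_iterate_derivative_of_reverse_eq
      (reverse_cyclotomic_int (by omega : 1 < n)) ((natDegree_cyclotomic n ℤ).trans hm) hk
    rw [hm]
    push_cast
    rwa [← mul_sub]
  · rw [iterate_derivative_eq_zero]
    · simp
    · rw [natDegree_cyclotomic]
      have := Nat.totient_le n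
      omega
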